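/- arXiv:1605.03516 — 2 statements merged into one kernel-verified Lean document; each statement's English description precedes it below -/
import Mathlib

section
/- Let A and B be n×n positive definite complex matrices and t ∈ [0,1]. Then the largest eigenvalue of A^{1/2}(A♯_t B)A^{1/2} is at most the largest eigenvalue of A^{1−t/2} B^t A^{1−t/2}. -/
open Matrix ComplexOrder

/-- Real power of a Hermitian matrix via the functional calculus (spectral decomposition). -/
noncomputable def mpow {n : ℕ} (A : Matrix (Fin n) (Fin n) ℂ) (r : ℝ) :
    Matrix (Fin n) (Fin n) ℂ :=
  if hA : A.IsHermitian then
    (hA.eigenvectorUnitary : Matrix (Fin n) (Fin n) ℂ) *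
      Matrix.diagonal (fun i => ((hA.eigenvalues i ^ r : ℝ) : ℂ)) *
      (star hA.eigenvectorUnitary : Matrix (Fin n) (Fin n) ℂ)
  else 0

/-- The t-geometric mean `A ♯ₜ B = A^{1/2} (A^{-1/2} B A^{-1/2})^t A^{1/2}`. -/
noncomputable def geomMean {n : ℕ} (A B : Matrix (Fin n) (Fin n) ℂ) (t : ℝ) :
    Matrix (Fin n) (Fin n) ℂ :=
  mpow A (1/2) * mpow (mpow A (-(1/2)) * B * mpow A (-(1/2))) t * mpow A (1/2)

/-- Eigenvalues of a Hermitian matrix in decreasing order. -/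
noncomputable def eigsDesc {n : ℕ} (M : Matrix (Fin n) (Fin n) ℂ) : Fin n → ℝ :=
  if hM : M.IsHermitian then fun i => hM.eigenvalues (Tuple.sort hM.eigenvalues (Fin.rev i))
  else 0

section CStar
variable {𝓐 : Type*} [CStarAlgebra 𝓐] [PartialOrder 𝓐] [StarOrderedRing 𝓐]

namespace CFC

lemma smul_rpow {r : ℝ} (hr : 0 < r) (a : 𝓐) (p : ℝ) (ha : IsStrictlyPositive a) :
    (r • a) ^ p = r ^ p • a ^ p := by
  lift r to NNReal using hr.le
  have hr' : r ≠ 0 := by rintro rfl; simp at hr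
  have h0 : 0 ∉ spectrum NNReal a := spectrum.zero_notMem _ ha.isUnit
  have hc (s : Set NNReal) (hs : 0 ∉ s) : ContinuousOn (fun x : NNReal => x ^ p) s := by
    intro x hx
    exact (NNReal.continuousAt_rpow_const (Or.inl (by rintro rfl; exact hs hx))).continuousWithinAt
  rw [← NNReal.coe_rpow]
  change (r • a) ^ p = r ^ p • a ^ p
  rw [rpow_def, rpow_def, ← cfc_comp_smul r (fun x : NNReal => x ^ p) a
    (hc _ (by rintro ⟨x, hx, h⟩; simp [hr'] at h; exact h0 (h ▸ hx))) ha.nonneg,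
    ← cfc_smul _ _ _ (hc _ h0)]
  simp [NNReal.mul_rpow]

/-- Powers of `y y⋆` in terms of powers of `y⋆ y`, for invertible `y`. -/
lemma rpow_mul_star_self {y : 𝓐} (hy : IsUnit y) (s : ℝ) :
    (y * star y) ^ s = y * (star y * y) ^ (s - 1) * star y := by
  have hc : IsStrictlyPositive (star y * y) :=
    (hy.star.mul hy).isStrictlyPositive (star_mul_self_nonneg y)
  set c := star y * y with hcdef
  have hs (r : ℝ) : star (c ^ r) = c ^ r := (IsSelfAdjoint.of_nonneg rpow_nonneg).star_eq
  have hu : IsUnit (c ^ (-(1 / 2) : ℝ)) := (IsStrictlyPositive.rpow c _).isUnit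
  have hmem : y * c ^ (-(1 / 2) : ℝ) ∈ unitary 𝓐 := by
    have h1 : star (y * c ^ (-(1 / 2) : ℝ)) * (y * c ^ (-(1 / 2) : ℝ)) = 1 := by
      rw [star_mul, hs, ← conjugate_rpow_neg_one_half c]
      simp only [hcdef, mul_assoc]
    refine Unitary.mem_iff.2 ⟨h1, ?_⟩
    obtain ⟨v, hv⟩ := hy.mul hu
    rw [← hv] at h1 ⊢
    rw [Units.eq_inv_of_mul_eq_one_right h1, Units.mul_inv]
  let φ := Unitary.conjStarAlgAut ℂ 𝓐 ⟨_, hmem⟩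
  have hφ (r : ℝ) : φ (c ^ r) = y * c ^ (r - 1) * star y := by
    simp only [φ, Unitary.conjStarAlgAut_apply, star_mul, hs]
    rw [show r - 1 = -(1/2) + r + (-(1/2)) by ring, rpow_add hc.isUnit, rpow_add hc.isUnit]
    simp only [mul_assoc]
  have h1 : φ c = y * star y := by
    simpa [rpow_zero c hc.nonneg, rpow_one c hc.nonneg] using hφ 1
  have hcont : Continuous φ := by
    change Continuous fun x => φ x
    simp only [φ, Unitary.conjStarAlgAut_apply]
    fun_prop
  have hcts : ContinuousOn (fun x : NNReal => x ^ s) (spectrum NNReal c) := fun x hx =>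
    (NNReal.continuousAt_rpow_const (Or.inl (by
      rintro rfl; exact spectrum.zero_notMem _ hc.isUnit hx))).continuousWithinAt
  rw [← hφ, ← h1, rpow_def, rpow_def]
  exact (StarAlgHomClass.map_cfc (S := ℂ) φ _ c hcts hcont hc.nonneg
    (h1 ▸ mul_star_self_nonneg y)).symm

/-- `a ↦ a ^ (-p)` is operator antitone on strictly positive elements for `p ∈ [0,1]`. -/
lemma rpow_neg_le_rpow_neg {p : ℝ} (hp : p ∈ Set.Icc 0 1) {a b : 𝓐} (hab : a ≤ b)
    (ha : IsStrictlyPositive a) : b ^ (-p) ≤ a ^ (-p) := by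
  have hb := ha.of_le hab
  have h := rpow_le_rpow hp (CStarAlgebra.rpow_neg_one_le_rpow_neg_one hab ha)
  rwa [rpow_rpow b _ _ (by norm_num), rpow_rpow a _ _ (by norm_num), neg_one_mul] at h

/-- A Furuta-type inequality: `b ^ (t / (2 - t)) ≤ z` implies
`(z ^ (1/2) * b * z ^ (1/2)) ^ t ≤ z ^ 2`. -/
lemma conj_rpow_half_rpow_le_sq {t : ℝ} (ht : t ∈ Set.Icc 0 1) {b z : 𝓐}
    (hb : IsStrictlyPositive b) (hz : IsStrictlyPositive z) (h : b ^ (t / (2 - t)) ≤ z) :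
    (z ^ (1 / 2 : ℝ) * b * z ^ (1 / 2 : ℝ)) ^ t ≤ z ^ (2 : ℝ) := by
  obtain ⟨ht0, ht1⟩ := ht
  have h2t : 0 < 2 - t := by linarith
  have hs {c : 𝓐} (r : ℝ) : IsSelfAdjoint (c ^ r) := IsSelfAdjoint.of_nonneg rpow_nonneg
  have hhalf {c : 𝓐} (hc : IsStrictlyPositive c) : c ^ (1 / 2 : ℝ) * c ^ (1 / 2 : ℝ) = c := by
    rw [← rpow_add hc.isUnit, add_halves, rpow_one c hc.nonneg]
  have hadd {c : 𝓐} (hc : IsStrictlyPositive c) (r s : ℝ) :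
      c ^ r * c ^ s * c ^ r = c ^ (r + s + r) := by
    rw [rpow_add hc.isUnit, rpow_add hc.isUnit]
  set y := z ^ (1 / 2 : ℝ) * b ^ (1 / 2 : ℝ) with hy
  have hyu : IsUnit y :=
    (IsStrictlyPositive.rpow z _).isUnit.mul (IsStrictlyPositive.rpow b _).isUnit
  have hystar : star y = b ^ (1 / 2 : ℝ) * z ^ (1 / 2 : ℝ) := by
    rw [hy, star_mul, (hs _).star_eq, (hs _).star_eq]
  have hyy : z ^ (1 / 2 : ℝ) * b * z ^ (1 / 2 : ℝ) = y * star y := by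
    conv_lhs => rw [← hhalf hb]
    rw [hystar, hy]
    simp only [mul_assoc]
  have hyy' : star y * y = b ^ (1 / 2 : ℝ) * z * b ^ (1 / 2 : ℝ) := by
    conv_rhs => rw [← hhalf hz]
    rw [hystar, hy]
    simp only [mul_assoc]
  have h1 : b ^ (2 / (2 - t)) ≤ star y * y := by
    rw [hyy', show 2 / (2 - t) = 1 / 2 + t / (2 - t) + 1 / 2 by field_simp; ring, ← hadd hb]
    exact (hs _).conjugate_le_conjugate h
  have h2 : (star y * y) ^ (t - 1) ≤ b ^ (2 / (2 - t) * (t - 1)) := by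
    rw [← rpow_rpow b _ _ (by positivity), ← neg_sub 1 t]
    exact rpow_neg_le_rpow_neg ⟨by linarith, by linarith⟩ h1 (IsStrictlyPositive.rpow b _)
  calc
    _ = z ^ (1 / 2 : ℝ) * (b ^ (1 / 2 : ℝ) * (star y * y) ^ (t - 1) * b ^ (1 / 2 : ℝ)) *
          z ^ (1 / 2 : ℝ) := by
      rw [hyy, rpow_mul_star_self hyu, hystar, hy]
      simp only [mul_assoc]
    _ ≤ z ^ (1 / 2 : ℝ) * (b ^ (1 / 2 : ℝ) * b ^ (2 / (2 - t) * (t - 1)) * b ^ (1 / 2 : ℝ)) *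
          z ^ (1 / 2 : ℝ) :=
      (hs _).conjugate_le_conjugate ((hs _).conjugate_le_conjugate h2)
    _ = z ^ (1 / 2 : ℝ) * b ^ (t / (2 - t)) * z ^ (1 / 2 : ℝ) := by
      rw [hadd hb]
      congr 3
      field_simp
      ring
    _ ≤ z ^ (1 / 2 : ℝ) * z * z ^ (1 / 2 : ℝ) := (hs _).conjugate_le_conjugate h
    _ = z ^ (2 : ℝ) := by
      nth_rw 2 [← rpow_one z hz.nonneg]
      rw [hadd hz]
      norm_num

lemma conj_rpow_neg_half_rpow_le {t r : ℝ} (ht : t ∈ Set.Icc 0 1) (hr : 0 < r) {a b : 𝓐}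
    (ha : IsStrictlyPositive a) (hb : IsStrictlyPositive b)
    (h : a ^ (1 - t / 2) * b ^ t * a ^ (1 - t / 2) ≤ algebraMap ℝ 𝓐 r) :
    a * (a ^ (-(1 / 2) : ℝ) * b * a ^ (-(1 / 2) : ℝ)) ^ t * a ≤ algebraMap ℝ 𝓐 r := by
  have h2t : 0 < 2 - t := by linarith [ht.2]
  have hs {c : 𝓐} (p : ℝ) : IsSelfAdjoint (c ^ p) := IsSelfAdjoint.of_nonneg rpow_nonneg
  have hpos (p : ℝ) : IsStrictlyPositive (a ^ p) := IsStrictlyPositive.rpow a p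
  have hinv (p : ℝ) (c : 𝓐) : a ^ (-p) * (a ^ p * c * a ^ p) * a ^ (-p) = c := by
    rw [← mul_assoc, ← mul_assoc, rpow_neg_mul_rpow p ha, one_mul, mul_assoc,
      rpow_mul_rpow_neg p ha, mul_one]
  have hconj {p : ℝ} : a ^ p * algebraMap ℝ 𝓐 r * a ^ p = r • a ^ (2 * p) := by
    rw [two_mul, rpow_add ha.isUnit, Algebra.algebraMap_eq_smul_one]
    simp
  set q : ℝ := (2 - t)⁻¹ with hq
  have hbt : b ^ t ≤ r • a ^ (-(2 - t)) := by
    have := (hs (c := a) (-(1 - t / 2))).conjugate_le_conjugate h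
    rw [hinv, hconj] at this
    convert this using 3
    ring
  set μ := r ^ q with hμ
  have hμ0 : 0 < μ := Real.rpow_pos_of_pos hr q
  have hz : b ^ (t / (2 - t)) ≤ μ • a ^ (-1 : ℝ) := by
    have := rpow_le_rpow (p := q) ⟨by positivity, inv_le_one_of_one_le₀ (by linarith [ht.2])⟩ hbt
    rw [rpow_rpow_of_exponent_nonneg b _ _ ht.1 (by positivity) hb.nonneg,
      smul_rpow hr _ _ (hpos _), rpow_rpow a _ _ (by linarith)] at this
    rwa [show -(2 - t) * q = -1 by rw [hq]; field_simp] at this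
  have hzpos : IsStrictlyPositive (μ • a ^ (-1 : ℝ)) :=
    (IsStrictlyPositive.rpow b _).of_le hz
  have hcpos : IsStrictlyPositive (a ^ (-(1 / 2) : ℝ) * b * a ^ (-(1 / 2) : ℝ)) :=
    .conjugate_of_isUnit_of_isSelfAdjoint b _ (hpos _).isUnit (hs _) hb
  have key := conj_rpow_half_rpow_le_sq ht hb hzpos hz
  have hμhalf : μ ^ (1 / 2 : ℝ) * μ ^ (1 / 2 : ℝ) = μ := by
    rw [← Real.rpow_add hμ0, add_halves, Real.rpow_one]
  rw [smul_rpow hμ0 _ _ (hpos _), smul_rpow hμ0 _ _ (hpos _), rpow_rpow a _ _ (by norm_num),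
    rpow_rpow a _ _ (by norm_num), smul_mul_assoc, smul_mul_assoc, mul_smul_comm, smul_smul,
    hμhalf, neg_one_mul, neg_one_mul, smul_rpow hμ0 _ _ hcpos] at key
  have key2 : (a ^ (-(1 / 2) : ℝ) * b * a ^ (-(1 / 2) : ℝ)) ^ t ≤ r • a ^ (2 * (-1) : ℝ) := by
    have := smul_le_smul_of_nonneg_left key (Real.rpow_nonneg hμ0.le (-t))
    rw [smul_smul, smul_smul, ← Real.rpow_add hμ0, ← Real.rpow_add hμ0, neg_add_cancel,
      Real.rpow_zero, one_smul, hμ, ← Real.rpow_mul hr.le,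
      show q * (-t + 2) = 1 by rw [hq]; field_simp; ring, Real.rpow_one] at this
    simpa using this
  rw [← hconj] at key2
  have := (hs (c := a) 1).conjugate_le_conjugate key2
  have h3 := hinv (-1) (algebraMap ℝ 𝓐 r)
  rw [neg_neg] at h3
  rwa [h3, rpow_one a ha.nonneg] at this

end CFC
end CStar

open scoped MatrixOrder Matrix.Norms.L2Operator

lemma mpow_eq_rpow {n : ℕ} {A : Matrix (Fin n) (Fin n) ℂ} (hA : A.PosDef) (r : ℝ) :
    mpow A r = A ^ r := by
  have h : IsStrictlyPositive A := hA.isStrictlyPositive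
  rw [CFC.rpow_eq_cfc_real h.nonneg, hA.isHermitian.cfc_eq, mpow, dif_pos hA.isHermitian,
    IsHermitian.cfc, Unitary.conjStarAlgAut_apply]
  rfl

lemma eigsDesc_mem_spectrum {n : ℕ} {M : Matrix (Fin n) (Fin n) ℂ} (hM : M.IsHermitian)
    (i : Fin n) : eigsDesc M i ∈ spectrum ℝ M := by
  rw [eigsDesc, dif_pos hM]
  exact hM.eigenvalues_mem_spectrum_real _

/-- The largest eigenvalue is at most `r` iff `M ≤ r • 1` in the Loewner order. -/
lemma eigsDesc_zero_le_iff {n : ℕ} [NeZero n] {M : Matrix (Fin n) (Fin n) ℂ}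
    (hM : M.IsHermitian) (r : ℝ) :
    eigsDesc M 0 ≤ r ↔ M ≤ algebraMap ℝ (Matrix (Fin n) (Fin n) ℂ) r := by
  rw [le_algebraMap_iff_spectrum_le hM.isSelfAdjoint]
  refine ⟨fun h x hx => ?_, fun h => h _ (eigsDesc_mem_spectrum hM 0)⟩
  rw [hM.spectrum_real_eq_range_eigenvalues] at hx
  obtain ⟨j, rfl⟩ := hx
  refine le_trans ?_ h
  rw [eigsDesc, dif_pos hM]
  have hj : (Tuple.sort hM.eigenvalues).symm j ≤ Fin.rev 0 := by
    rw [← Fin.rev_le_rev, Fin.rev_rev]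
    exact Fin.zero_le _
  simpa using Tuple.monotone_sort hM.eigenvalues hj

/-- the largest eigenvalue of `A^{1/2}(A♯ₜB)A^{1/2}` is at most the largest
eigenvalue of `A^{1-t/2} Bᵗ A^{1-t/2}`. -/
theorem stmt_1 {n : ℕ} [NeZero n] (A B : Matrix (Fin n) (Fin n) ℂ)
    (hA : A.PosDef) (hB : B.PosDef) (t : ℝ) (ht : t ∈ Set.Icc (0:ℝ) 1) :
    eigsDesc (mpow A (1/2) * geomMean A B t * mpow A (1/2)) 0 ≤
      eigsDesc (mpow A (1 - t/2) * mpow B t * mpow A (1 - t/2)) 0 := by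
  have hA' : IsStrictlyPositive A := hA.isStrictlyPositive
  have hB' : IsStrictlyPositive B := hB.isStrictlyPositive
  have hconj {C : Matrix (Fin n) (Fin n) ℂ} (hC : IsStrictlyPositive C) (r : ℝ) :
      IsStrictlyPositive (A ^ r * C * A ^ r) :=
    .conjugate_of_isUnit_of_isSelfAdjoint C _ (IsStrictlyPositive.rpow A r).isUnit
      (IsSelfAdjoint.of_nonneg CFC.rpow_nonneg) hC
  have hC := hconj hB' (-(1 / 2))
  have hL : mpow A (1/2) * geomMean A B t * mpow A (1/2) =
      A * (A ^ (-(1 / 2) : ℝ) * B * A ^ (-(1 / 2) : ℝ)) ^ t * A := by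
    have hhalf : A ^ (1 / 2 : ℝ) * A ^ (1 / 2 : ℝ) = A := by
      rw [← CFC.rpow_add hA'.isUnit, add_halves, CFC.rpow_one A hA'.nonneg]
    rw [geomMean, mpow_eq_rpow hA, mpow_eq_rpow hA, mpow_eq_rpow hC.posDef]
    generalize (A ^ (-(1 / 2) : ℝ) * B * A ^ (-(1 / 2) : ℝ)) ^ t = C
    conv_rhs => rw [← hhalf]
    simp only [mul_assoc]
  have hR := hconj (IsStrictlyPositive.rpow B t) (1 - t / 2)
  have hLH : IsStrictlyPositive (A * (A ^ (-(1 / 2) : ℝ) * B * A ^ (-(1 / 2) : ℝ)) ^ t * A) := by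
    simpa only [CFC.rpow_one A hA'.nonneg] using hconj (IsStrictlyPositive.rpow _ t hC) 1
  rw [hL, mpow_eq_rpow hA, mpow_eq_rpow hB, eigsDesc_zero_le_iff hLH.posDef.isHermitian]
  exact CFC.conj_rpow_neg_half_rpow_le ht
    (hR.spectrum_pos (eigsDesc_mem_spectrum hR.posDef.isHermitian 0)) hA' hB'
    ((eigsDesc_zero_le_iff hR.posDef.isHermitian _).1 le_rfl)
end

section
/- Let A and B be n×n positive definite complex matrices, t ∈ [0,1] and r ≥ 0. Then ‖A + B + r(A♯_t B + A♯_{1−t} B)‖₁ ≤ ‖A + B + r(A^t B^{1−t} + A^{1−t} B^t)‖₁, where ‖X‖₁ = Tr((X*X)^{1/2}) is the trace norm and X* denotes the conjugate transpose. -/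
open Matrix ComplexOrder

/-- The trace norm ‖X‖₁ = Tr((X*X)^{1/2}). -/
noncomputable def traceNorm {n : ℕ} (X : Matrix (Fin n) (Fin n) ℂ) : ℝ :=
  ((mpow (Xᴴ * X) (1/2)).trace).re

/-- The Hilbert–Schmidt (Frobenius) norm ‖X‖₂ = (Tr(X*X))^{1/2}. -/
noncomputable def hsNorm {n : ℕ} (X : Matrix (Fin n) (Fin n) ℂ) : ℝ :=
  Real.sqrt ((Xᴴ * X).trace.re)

open MeasureTheory Set in
theorem integrableOn_sum_rpowIntegrand₀₁ {ι : Type*} [Fintype ι] (α c : ι → ℝ)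
    (hc : ∀ k, 0 ≤ c k) {t : ℝ} (ht : t ∈ Ioo (0 : ℝ) 1) :
    IntegrableOn (fun s => ∑ k, α k * Real.rpowIntegrand₀₁ t s (c k)) (Ioi 0) :=
  integrable_finsetSum _ fun k _ =>
    (Real.integrableOn_rpowIntegrand₀₁_Ioi ht (hc k)).const_mul (α k)

open MeasureTheory Set in
theorem integral_sum_rpowIntegrand₀₁ {ι : Type*} [Fintype ι] (α c : ι → ℝ)
    (hc : ∀ k, 0 ≤ c k) {t : ℝ} (ht : t ∈ Ioo (0 : ℝ) 1) :
    ∫ s in Ioi 0, ∑ k, α k * Real.rpowIntegrand₀₁ t s (c k) =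
      (∑ k, α k * c k ^ t) * ∫ s in Ioi 0, Real.rpowIntegrand₀₁ t s 1 := by
  rw [integral_finsetSum _ fun k _ =>
    (Real.integrableOn_rpowIntegrand₀₁_Ioi ht (hc k)).const_mul (α k), Finset.sum_mul]
  refine Finset.sum_congr rfl fun k _ => ?_
  rw [integral_const_mul, Real.integral_rpowIntegrand₀₁_eq_rpow_mul_const ht (hc k), mul_assoc]

theorem sum_rpowIntegrand₀₁_eq {ι : Type*} [Fintype ι] (α c : ι → ℝ)
    (hc : ∀ k, 0 ≤ c k) {t : ℝ} (ht : t ∈ Set.Ioo (0 : ℝ) 1) {s : ℝ} (hs : 0 < s) :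
    ∑ k, α k * Real.rpowIntegrand₀₁ t s (c k) =
      s ^ (t - 1) * ∑ k, α k * (c k / (s + c k)) := by
  rw [Finset.mul_sum]
  refine Finset.sum_congr rfl fun k _ => ?_
  rw [Real.rpowIntegrand₀₁_eq_pow_div ht hs.le (hc k)]
  ring

open MeasureTheory Set in
/-- An inequality between weighted sums of resolvent functions integrates to one between powers. -/
theorem sum_rpow_le_sum_rpow_of_resolvent {ι κ : Type*} [Fintype ι] [Fintype κ]
    (α c : ι → ℝ) (β x : κ → ℝ) (hc : ∀ k, 0 ≤ c k) (hx : ∀ l, 0 ≤ x l)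
    (h : ∀ s : ℝ, 0 < s → ∑ k, α k * (c k / (s + c k)) ≤ ∑ l, β l * (x l / (s + x l)))
    {t : ℝ} (ht : t ∈ Ioo (0 : ℝ) 1) :
    ∑ k, α k * c k ^ t ≤ ∑ l, β l * x l ^ t := by
  refine le_of_mul_le_mul_right ?_ (Real.integral_rpowIntegrand₀₁_one_pos ht)
  rw [← integral_sum_rpowIntegrand₀₁ α c hc ht, ← integral_sum_rpowIntegrand₀₁ β x hx ht]
  refine setIntegral_mono_on (integrableOn_sum_rpowIntegrand₀₁ α c hc ht)
    (integrableOn_sum_rpowIntegrand₀₁ β x hx ht) measurableSet_Ioi fun s hs => ?_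
  rw [sum_rpowIntegrand₀₁_eq α c hc ht hs, sum_rpowIntegrand₀₁_eq β x hx ht hs]
  exact mul_le_mul_of_nonneg_left (h s hs) (Real.rpow_nonneg (le_of_lt hs) _)

section TraceInequality

variable {ι κ : Type*} [Fintype ι]

theorem re_trace_mul_diagonal_mul_conjTranspose [Fintype κ] [DecidableEq κ] (X : Matrix ι κ ℂ) (d : κ → ℝ) :
    (X * diagonal (fun k => (d k : ℂ)) * Xᴴ).trace.re = ∑ k, d k * ∑ i, ‖X i k‖ ^ 2 := by
  simp only [trace, diag, mul_apply (N := Xᴴ), mul_diagonal, conjTranspose_apply, Complex.re_sum]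
  rw [Finset.sum_comm]
  refine Finset.sum_congr rfl fun k _ => ?_
  rw [Finset.mul_sum]
  refine Finset.sum_congr rfl fun i _ => ?_
  rw [← Complex.normSq_eq_norm_sq, Complex.normSq_apply]
  simp
  ring

theorem re_conjTranspose_mul_self_apply (X : Matrix ι κ ℂ) (k : κ) :
    ((Xᴴ * X) k k).re = ∑ i, ‖X i k‖ ^ 2 := by
  simp only [mul_apply, conjTranspose_apply, Complex.re_sum]
  refine Finset.sum_congr rfl fun i _ => ?_
  rw [← Complex.normSq_eq_norm_sq, Complex.normSq_apply]
  simp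

theorem two_mul_re_conjTranspose_mul_apply_le (X Y : Matrix ι κ ℂ) (k : κ) (s : ℝ) :
    2 * s * ((Xᴴ * Y) k k).re ≤ ∑ i, ‖X i k‖ ^ 2 + s ^ 2 * ∑ i, ‖Y i k‖ ^ 2 := by
  simp only [mul_apply, conjTranspose_apply, Complex.re_sum]
  rw [Finset.mul_sum, Finset.mul_sum, ← Finset.sum_add_distrib]
  refine Finset.sum_le_sum fun i _ => ?_
  rw [← Complex.normSq_eq_norm_sq, Complex.normSq_apply,
    ← Complex.normSq_eq_norm_sq, Complex.normSq_apply]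
  simp
  nlinarith [sq_nonneg ((X i k).re - s * (Y i k).re), sq_nonneg ((X i k).im - s * (Y i k).im)]

/-- Resolvent form of the comparison between the trace of a geometric mean and the trace of a
product of powers: `P Pᴴ` and `Q diag(c) Qᴴ` are diagonal and `M` intertwines `P` and `Q`. -/
theorem sum_resolvent_le_of_intertwining [Fintype κ] [DecidableEq ι] [DecidableEq κ]
    (M : Matrix ι ι ℂ) (P Q : Matrix ι κ ℂ) (a b : ι → ℝ) (c : κ → ℝ)
    (ha : ∀ i, 0 < a i) (hb : ∀ i, 0 < b i) (hc : ∀ k, 0 < c k)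
    (hMQ : M * Q = P) (hMP : Mᴴ * P = Q)
    (hP : P * Pᴴ = diagonal fun i => (a i : ℂ))
    (hQ : Q * diagonal (fun k => (c k : ℂ)) * Qᴴ = diagonal fun i => (b i : ℂ))
    {s : ℝ} (hs : 0 < s) :
    ∑ k, (∑ i, ‖P i k‖ ^ 2) * (c k / (s + c k)) ≤
      ∑ i, ∑ j, ‖M i j‖ ^ 2 * (a i * b j / (s * a i + b j)) := by
  let N : Matrix ι ι ℂ := of fun i j => ((b j / (s * a i + b j) : ℝ) : ℂ) * M i j
  let L : Matrix ι ι ℂ := of fun i j => ((s * a i / (s * a i + b j) : ℝ) : ℂ) * M i j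
  have hden : ∀ i j, 0 < s * a i + b j := fun i j => by
    have := mul_pos hs (ha i)
    linarith [hb j]
  have hNL : N + L = M := by
    ext i j
    simp only [N, L, Matrix.add_apply, of_apply]
    rw [← add_mul, ← Complex.ofReal_add, ← add_div, add_comm (b j), div_self (hden i j).ne']
    simp
  have hN : ∑ k, ∑ j, ‖(Nᴴ * P) j k‖ ^ 2 = ∑ i, a i * ∑ j, ‖N i j‖ ^ 2 := by
    have h₁ := re_trace_mul_diagonal_mul_conjTranspose (Nᴴ * P) (fun _ : κ => (1 : ℝ))
    have h₂ := re_trace_mul_diagonal_mul_conjTranspose Nᴴ a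
    rw [← hP] at h₂
    simp only [one_mul, Complex.ofReal_one, diagonal_one, Matrix.mul_one,
      conjTranspose_mul, conjTranspose_conjTranspose, conjTranspose_apply, norm_star,
      Matrix.mul_assoc] at h₁ h₂
    rw [← h₁, h₂]
  have hL : ∑ k, c k * ∑ i, ‖(L * Q) i k‖ ^ 2 = ∑ j, b j * ∑ i, ‖L i j‖ ^ 2 := by
    rw [← re_trace_mul_diagonal_mul_conjTranspose, ← re_trace_mul_diagonal_mul_conjTranspose, ← hQ]
    simp only [conjTranspose_mul, Matrix.mul_assoc]
  have hPQ : ∀ k, ∑ i, ‖Q i k‖ ^ 2 = ∑ i, ‖P i k‖ ^ 2 := fun k => by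
    rw [← re_conjTranspose_mul_self_apply, ← re_conjTranspose_mul_self_apply]
    nth_rewrite 2 [← hMP]
    conv_rhs => rw [← hMQ, conjTranspose_mul, Matrix.mul_assoc, hMQ]
  have hcol : ∀ k, (∑ i, ‖P i k‖ ^ 2) * (c k / (s + c k)) ≤
      ∑ j, ‖(Nᴴ * P) j k‖ ^ 2 + s⁻¹ * (c k * ∑ i, ‖(L * Q) i k‖ ^ 2) := fun k => by
    have hsplit : ∑ i, ‖P i k‖ ^ 2 = (((Nᴴ * P)ᴴ * Q) k k).re + (((L * Q)ᴴ * P) k k).re := by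
      have hre : (((L * Q)ᴴ * P) k k).re = ((Pᴴ * (L * Q)) k k).re := by
        rw [← Complex.conj_re, starRingEnd_apply, ← conjTranspose_apply, conjTranspose_mul,
          conjTranspose_conjTranspose]
      rw [hre, ← Complex.add_re, ← Matrix.add_apply, ← re_conjTranspose_mul_self_apply]
      simp only [conjTranspose_mul, conjTranspose_conjTranspose, Matrix.mul_assoc]
      rw [← Matrix.mul_add, ← Matrix.add_mul, hNL, hMQ]
    have h₁ := two_mul_re_conjTranspose_mul_apply_le (Nᴴ * P) Q k (c k / (s + c k))
    have h₂ := two_mul_re_conjTranspose_mul_apply_le (L * Q) P k (s / (s + c k))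
    rw [hPQ] at h₁
    have hck := hc k
    have h₃ := mul_le_mul_of_nonneg_left h₂ (show 0 ≤ s⁻¹ * c k by positivity)
    generalize (((Nᴴ * P)ᴴ * Q) k k).re = x at *
    generalize (((L * Q)ᴴ * P) k k).re = y at *
    have e₁ : s⁻¹ * c k * (2 * (s / (s + c k)) * y) = 2 * (c k / (s + c k)) * y := by
      field_simp
    have e₂ : ∀ h : ℝ, (c k / (s + c k)) ^ 2 * h + s⁻¹ * c k * ((s / (s + c k)) ^ 2 * h) =
        h * (c k / (s + c k)) := fun h => by
      field_simp
      ring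
    have e₃ := e₂ (∑ i, ‖P i k‖ ^ 2)
    rw [e₁, mul_add] at h₃
    have e₄ : 2 * ((∑ i, ‖P i k‖ ^ 2) * (c k / (s + c k))) =
        2 * (c k / (s + c k)) * x + 2 * (c k / (s + c k)) * y := by
      rw [hsplit]; ring
    linarith
  refine (Finset.sum_le_sum fun k _ => hcol k).trans_eq ?_
  rw [Finset.sum_add_distrib, ← Finset.mul_sum, hN, hL]
  simp only [Finset.mul_sum]
  rw [Finset.sum_comm (γ := ι) (f := fun j i => s⁻¹ * (b j * ‖L i j‖ ^ 2)),
    ← Finset.sum_add_distrib]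
  refine Finset.sum_congr rfl fun i _ => ?_
  rw [← Finset.sum_add_distrib]
  refine Finset.sum_congr rfl fun j _ => ?_
  have hd := (hden i j).ne'
  simp only [N, L, of_apply, norm_mul, mul_pow, Complex.norm_real, Real.norm_eq_abs, sq_abs]
  generalize hD : s * a i + b j = D at *
  field_simp
  rw [← hD]
  ring

end TraceInequality

section MPow

variable {n : ℕ} {A B : Matrix (Fin n) (Fin n) ℂ}

theorem mpow_eq_mul_diagonal_mul (hA : A.IsHermitian) (r : ℝ) :
    mpow A r = (hA.eigenvectorUnitary : Matrix (Fin n) (Fin n) ℂ) *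
      diagonal (fun i => ((hA.eigenvalues i ^ r : ℝ) : ℂ)) *
      (hA.eigenvectorUnitary : Matrix (Fin n) (Fin n) ℂ)ᴴ := by
  rw [mpow, dif_pos hA]
  rfl

theorem eigenvectorUnitary_conjTranspose_mul_self (hA : A.IsHermitian) :
    (hA.eigenvectorUnitary : Matrix (Fin n) (Fin n) ℂ)ᴴ * hA.eigenvectorUnitary = 1 :=
  Unitary.coe_star_mul_self hA.eigenvectorUnitary

theorem eigenvectorUnitary_mul_conjTranspose_self (hA : A.IsHermitian) :
    (hA.eigenvectorUnitary : Matrix (Fin n) (Fin n) ℂ) *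
      (hA.eigenvectorUnitary : Matrix (Fin n) (Fin n) ℂ)ᴴ = 1 :=
  Unitary.coe_mul_star_self hA.eigenvectorUnitary

theorem mpow_one (hA : A.IsHermitian) : mpow A 1 = A := by
  conv_rhs => rw [hA.spectral_theorem]
  rw [mpow, dif_pos hA]
  simp [Function.comp_def, Unitary.conjStarAlgAut_apply]

theorem eq_mul_diagonal_eigenvalues_mul (hA : A.IsHermitian) :
    A = (hA.eigenvectorUnitary : Matrix (Fin n) (Fin n) ℂ) *
      diagonal (fun i => (hA.eigenvalues i : ℂ)) *
      (hA.eigenvectorUnitary : Matrix (Fin n) (Fin n) ℂ)ᴴ := by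
  simpa using (mpow_one hA).symm.trans (mpow_eq_mul_diagonal_mul hA 1)

theorem mpow_zero (hA : A.IsHermitian) : mpow A 0 = 1 := by
  simp [mpow_eq_mul_diagonal_mul hA, eigenvectorUnitary_mul_conjTranspose_self hA]

theorem mpow_isHermitian (hA : A.IsHermitian) (r : ℝ) : (mpow A r).IsHermitian := by
  rw [mpow_eq_mul_diagonal_mul hA]
  refine isHermitian_mul_mul_conjTranspose _ ?_
  exact isHermitian_diagonal_of_self_adjoint _ (by ext i; simp)

theorem mpow_mul_mpow (hA : A.PosDef) (r s : ℝ) : mpow A r * mpow A s = mpow A (r + s) := by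
  have hU := eigenvectorUnitary_conjTranspose_mul_self hA.isHermitian
  simp only [mpow_eq_mul_diagonal_mul hA.isHermitian, Matrix.mul_assoc]
  rw [← Matrix.mul_assoc _ _ (diagonal _ * _), hU, Matrix.one_mul,
    ← Matrix.mul_assoc (diagonal _) (diagonal _), diagonal_mul_diagonal]
  simp [Real.rpow_add (hA.eigenvalues_pos _)]

theorem mpow_half_mul_self (hA : A.PosSemidef) : mpow A (1 / 2) * mpow A (1 / 2) = A := by
  have hU := eigenvectorUnitary_conjTranspose_mul_self hA.isHermitian
  conv_rhs => rw [eq_mul_diagonal_eigenvalues_mul hA.isHermitian]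
  simp only [mpow_eq_mul_diagonal_mul hA.isHermitian, Matrix.mul_assoc]
  rw [← Matrix.mul_assoc _ _ (diagonal _ * _), hU, Matrix.one_mul,
    ← Matrix.mul_assoc (diagonal _) (diagonal _), diagonal_mul_diagonal]
  simp only [← Complex.ofReal_mul, ← Real.sqrt_eq_rpow,
    Real.mul_self_sqrt (hA.eigenvalues_nonneg _)]

theorem mpow_posSemidef (hA : A.PosSemidef) (r : ℝ) : (mpow A r).PosSemidef := by
  rw [mpow_eq_mul_diagonal_mul hA.isHermitian]
  refine PosSemidef.mul_mul_conjTranspose_same (PosSemidef.diagonal fun i => ?_) _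
  exact Complex.zero_le_real.2 (Real.rpow_nonneg (hA.eigenvalues_nonneg i) r)

theorem re_trace_mpow_mul_mpow (hA : A.IsHermitian) (hB : B.IsHermitian) (r s : ℝ) :
    (mpow A r * mpow B s).trace.re = ∑ i, ∑ j,
      ‖((hA.eigenvectorUnitary : Matrix (Fin n) (Fin n) ℂ)ᴴ * hB.eigenvectorUnitary) i j‖ ^ 2 *
        (hA.eigenvalues i ^ r * hB.eigenvalues j ^ s) := by
  rw [mpow_eq_mul_diagonal_mul hA, mpow_eq_mul_diagonal_mul hB]
  set U := (hA.eigenvectorUnitary : Matrix (Fin n) (Fin n) ℂ)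
  set V := (hB.eigenvectorUnitary : Matrix (Fin n) (Fin n) ℂ)
  have h : ∀ D E : Matrix (Fin n) (Fin n) ℂ, (U * D * Uᴴ * (V * E * Vᴴ)).trace =
      (D * ((Uᴴ * V) * E * (Uᴴ * V)ᴴ)).trace := fun D E => by
    rw [Matrix.mul_assoc, Matrix.mul_assoc, trace_mul_comm]
    simp only [conjTranspose_mul, conjTranspose_conjTranspose, Matrix.mul_assoc]
  rw [h]
  simp only [trace, diag, diagonal_mul, Complex.re_sum, Complex.re_ofReal_mul]
  refine Finset.sum_congr rfl fun i _ => ?_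
  simp only [mul_apply (N := (Uᴴ * V)ᴴ), mul_diagonal, Complex.re_sum, Finset.mul_sum]
  refine Finset.sum_congr rfl fun j _ => ?_
  rw [← Complex.normSq_eq_norm_sq, Complex.normSq_apply, conjTranspose_apply]
  simp
  ring

theorem posDef_mpow_neg_half_conj (hA : A.PosDef) (hB : B.PosDef) :
    (mpow A (-(1 / 2)) * B * mpow A (-(1 / 2))).PosDef := by
  have h := mpow_isHermitian hA.isHermitian (-(1 / 2))
  have hinv : mpow A (1 / 2) * mpow A (-(1 / 2)) = 1 := by
    rw [mpow_mul_mpow hA, add_neg_cancel, mpow_zero hA.isHermitian]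
  have := hB.conjTranspose_mul_mul_same (B := mpow A (-(1 / 2)))
    (mulVec_injective_of_isUnit (IsUnit.of_mul_eq_one_right _ hinv))
  rwa [h.eq] at this

theorem geomMean_posSemidef (hA : A.PosDef) (hB : B.PosDef) (t : ℝ) :
    (geomMean A B t).PosSemidef := by
  have := (mpow_posSemidef (posDef_mpow_neg_half_conj hA hB).posSemidef t).mul_mul_conjTranspose_same
    (mpow A (1 / 2))
  rwa [(mpow_isHermitian hA.isHermitian _).eq] at this

theorem mpow_half_mul_mul_mpow_half (hA : A.PosDef) :
    mpow A (1 / 2) * (mpow A (-(1 / 2)) * B * mpow A (-(1 / 2))) * mpow A (1 / 2) = B := by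
  have h₁ : mpow A (1 / 2) * mpow A (-(1 / 2)) = 1 := by
    rw [mpow_mul_mpow hA, add_neg_cancel, mpow_zero hA.isHermitian]
  have h₂ : mpow A (-(1 / 2)) * mpow A (1 / 2) = 1 := by
    rw [mpow_mul_mpow hA, neg_add_cancel, mpow_zero hA.isHermitian]
  simp only [← Matrix.mul_assoc, h₁, Matrix.one_mul]
  rw [Matrix.mul_assoc, h₂, Matrix.mul_one]

theorem geomMean_zero (hA : A.PosDef) (hB : B.PosDef) : geomMean A B 0 = A := by
  rw [geomMean, mpow_zero (posDef_mpow_neg_half_conj hA hB).isHermitian, Matrix.mul_one,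
    mpow_half_mul_self hA.posSemidef]

theorem geomMean_one (hA : A.PosDef) (hB : B.PosDef) : geomMean A B 1 = B := by
  rw [geomMean, mpow_one (posDef_mpow_neg_half_conj hA hB).isHermitian,
    mpow_half_mul_mul_mpow_half hA]

/-- `Tr (A ♯ₜ B) ≤ Tr (A^{1-t} B^t)`. -/
theorem re_trace_geomMean_le (hA : A.PosDef) (hB : B.PosDef) {t : ℝ}
    (ht : t ∈ Set.Icc (0 : ℝ) 1) :
    (geomMean A B t).trace.re ≤ (mpow A (1 - t) * mpow B t).trace.re := by
  rcases eq_or_lt_of_le ht.1 with rfl | ht₀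
  · simp [geomMean_zero hA hB, mpow_one hA.isHermitian, mpow_zero hB.isHermitian]
  rcases eq_or_lt_of_le ht.2 with rfl | ht₁
  · simp [geomMean_one hA hB, mpow_one hB.isHermitian, mpow_zero hA.isHermitian]
  have hC := posDef_mpow_neg_half_conj hA hB
  have hconj := mpow_half_mul_mul_mpow_half (B := B) hA
  have hgeom : geomMean A B t =
      mpow A (1 / 2) * mpow (mpow A (-(1 / 2)) * B * mpow A (-(1 / 2))) t * mpow A (1 / 2) := rfl
  rw [re_trace_mpow_mul_mpow hA.isHermitian hB.isHermitian]
  generalize mpow A (-(1 / 2)) * B * mpow A (-(1 / 2)) = C at *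
  have hS := (mpow_isHermitian hA.isHermitian (1 / 2)).eq
  have hSS := mpow_half_mul_self hA.posSemidef
  generalize mpow A (1 / 2) = S at *
  have hCspec := eq_mul_diagonal_eigenvalues_mul hC.isHermitian
  have hAspec := eq_mul_diagonal_eigenvalues_mul hA.isHermitian
  have hBspec := eq_mul_diagonal_eigenvalues_mul hB.isHermitian
  have hXX := eigenvectorUnitary_mul_conjTranspose_self hC.isHermitian
  have hUU := eigenvectorUnitary_conjTranspose_mul_self hA.isHermitian
  have hUU' := eigenvectorUnitary_mul_conjTranspose_self hA.isHermitian
  have hVV := eigenvectorUnitary_conjTranspose_mul_self hB.isHermitian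
  have hVV' := eigenvectorUnitary_mul_conjTranspose_self hB.isHermitian
  rw [mpow_eq_mul_diagonal_mul hC.isHermitian] at hgeom
  have ha := hA.eigenvalues_pos
  have hb := hB.eigenvalues_pos
  have hc := hC.eigenvalues_pos
  set X := (hC.isHermitian.eigenvectorUnitary : Matrix (Fin n) (Fin n) ℂ)
  set U := (hA.isHermitian.eigenvectorUnitary : Matrix (Fin n) (Fin n) ℂ)
  set V := (hB.isHermitian.eigenvectorUnitary : Matrix (Fin n) (Fin n) ℂ)
  set a := hA.isHermitian.eigenvalues
  set b := hB.isHermitian.eigenvalues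
  set c := hC.isHermitian.eigenvalues
  have hWW : (S * X) * (S * X)ᴴ = A := by
    rw [conjTranspose_mul, hS, Matrix.mul_assoc, ← Matrix.mul_assoc X, hXX, Matrix.one_mul, hSS]
  have hWcW : (S * X) * diagonal (fun k => (c k : ℂ)) * (S * X)ᴴ = B := by
    rw [← hconj, conjTranspose_mul, hS]
    conv_rhs => rw [hCspec]
    simp only [Matrix.mul_assoc]
  have hgeom' : geomMean A B t =
      (S * X) * diagonal (fun k => ((c k ^ t : ℝ) : ℂ)) * (S * X)ᴴ := by
    rw [hgeom, conjTranspose_mul, hS]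
    simp only [Matrix.mul_assoc]
  generalize S * X = W at *
  have htrace : (geomMean A B t).trace.re = ∑ k, (∑ i, ‖(Uᴴ * W) i k‖ ^ 2) * c k ^ t := by
    rw [hgeom', re_trace_mul_diagonal_mul_conjTranspose]
    refine Finset.sum_congr rfl fun k _ => ?_
    rw [mul_comm, ← re_conjTranspose_mul_self_apply, ← re_conjTranspose_mul_self_apply,
      conjTranspose_mul, conjTranspose_conjTranspose, Matrix.mul_assoc, ← Matrix.mul_assoc U,
      hUU', Matrix.one_mul]
  have hsum : ∑ i, ∑ j, ‖(Uᴴ * V) i j‖ ^ 2 * (a i ^ (1 - t) * b j ^ t) =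
      ∑ l : Fin n × Fin n, (‖(Uᴴ * V) l.1 l.2‖ ^ 2 * a l.1) * (b l.2 / a l.1) ^ t := by
    rw [Fintype.sum_prod_type]
    refine Finset.sum_congr rfl fun i _ => Finset.sum_congr rfl fun j _ => ?_
    rw [Real.div_rpow (hb j).le (ha i).le, Real.rpow_sub (ha i), Real.rpow_one]
    ring
  rw [htrace, hsum]
  refine sum_rpow_le_sum_rpow_of_resolvent _ _ _ _ (fun k => (hc k).le)
    (fun l => (div_pos (hb _) (ha _)).le) (fun s hs => ?_) ⟨ht₀, ht₁⟩
  refine (sum_resolvent_le_of_intertwining (Uᴴ * V) (Uᴴ * W) (Vᴴ * W) a b c ha hb hc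
    ?_ ?_ ?_ ?_ hs).trans_eq ?_
  · rw [Matrix.mul_assoc, ← Matrix.mul_assoc V, hVV', Matrix.one_mul]
  · rw [conjTranspose_mul, conjTranspose_conjTranspose, Matrix.mul_assoc, ← Matrix.mul_assoc U,
      hUU', Matrix.one_mul]
  · rw [conjTranspose_mul, conjTranspose_conjTranspose, Matrix.mul_assoc, ← Matrix.mul_assoc W,
      hWW, hAspec]
    simp only [Matrix.mul_assoc, hUU, Matrix.mul_one]
    rw [← Matrix.mul_assoc, hUU, Matrix.one_mul]
  · have : Vᴴ * W * diagonal (fun k => (c k : ℂ)) * (Vᴴ * W)ᴴ =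
        Vᴴ * (W * diagonal (fun k => (c k : ℂ)) * Wᴴ) * V := by
      simp only [conjTranspose_mul, conjTranspose_conjTranspose, Matrix.mul_assoc]
    rw [this, hWcW, hBspec]
    simp only [Matrix.mul_assoc, hVV, Matrix.mul_one]
    rw [← Matrix.mul_assoc, hVV, Matrix.one_mul]
  · rw [Fintype.sum_prod_type]
    refine Finset.sum_congr rfl fun i _ => Finset.sum_congr rfl fun j _ => ?_
    have hai := ha i
    have hbj := hb j
    field_simp

theorem re_trace_le_traceNorm (X : Matrix (Fin n) (Fin n) ℂ) : X.trace.re ≤ traceNorm X := by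
  have hH : (Xᴴ * X).IsHermitian := isHermitian_conjTranspose_mul_self X
  have hspec := eq_mul_diagonal_eigenvalues_mul hH
  have hVV := eigenvectorUnitary_conjTranspose_mul_self hH
  have hVV' := eigenvectorUnitary_mul_conjTranspose_self hH
  rw [traceNorm, mpow_eq_mul_diagonal_mul hH, trace_mul_comm, ← Matrix.mul_assoc, hVV,
    Matrix.one_mul]
  set V := (hH.eigenvectorUnitary : Matrix (Fin n) (Fin n) ℂ)
  set d := hH.eigenvalues
  have htr : X.trace = (Vᴴ * X * V).trace := by
    rw [trace_mul_comm, ← Matrix.mul_assoc, hVV', Matrix.one_mul]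
  have hY : (Vᴴ * X * V)ᴴ * (Vᴴ * X * V) = diagonal fun i => (d i : ℂ) := by
    have : (Vᴴ * X * V)ᴴ * (Vᴴ * X * V) = Vᴴ * (Xᴴ * ((V * Vᴴ) * X)) * V := by
      simp only [conjTranspose_mul, conjTranspose_conjTranspose, Matrix.mul_assoc]
    rw [this, hVV', Matrix.one_mul, hspec]
    simp only [Matrix.mul_assoc, hVV, Matrix.mul_one]
    rw [← Matrix.mul_assoc, hVV, Matrix.one_mul]
  rw [htr]
  simp only [trace, diag, Complex.re_sum, diagonal_apply_eq, Complex.ofReal_re]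
  refine Finset.sum_le_sum fun i _ => ?_
  have hdi : d i = ∑ j, ‖(Vᴴ * X * V) j i‖ ^ 2 := by
    rw [← re_conjTranspose_mul_self_apply, hY]
    simp
  rw [← Real.sqrt_eq_rpow]
  refine (Complex.re_le_norm _).trans (Real.le_sqrt_of_sq_le ?_)
  rw [hdi]
  exact Finset.single_le_sum (f := fun j => ‖(Vᴴ * X * V) j i‖ ^ 2)
    (fun j _ => sq_nonneg _) (Finset.mem_univ i)

open scoped MatrixOrder Matrix.Norms.L2Operator in
theorem traceNorm_eq_re_trace {X : Matrix (Fin n) (Fin n) ℂ} (hX : X.PosSemidef) :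
    traceNorm X = X.trace.re := by
  have h := posSemidef_conjTranspose_mul_self X
  have h₁ := CFC.sqrt_unique (mpow_half_mul_self h) (mpow_posSemidef h _).nonneg
  have h₂ : CFC.sqrt (Xᴴ * X) = X := CFC.sqrt_unique (by rw [hX.isHermitian.eq]) hX.nonneg
  rw [traceNorm, ← h₁, h₂]

end MPow

/-- `‖A + B + r(A♯ₜB + A♯₁₋ₜB)‖₁ ≤ ‖A + B + r(AᵗB^{1-t} + A^{1-t}Bᵗ)‖₁`. -/
theorem stmt_8 {n : ℕ} (A B : Matrix (Fin n) (Fin n) ℂ)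
    (hA : A.PosDef) (hB : B.PosDef) (t : ℝ) (ht : t ∈ Set.Icc (0:ℝ) 1)
    (r : ℝ) (hr : 0 ≤ r) :
    traceNorm (A + B + r • (geomMean A B t + geomMean A B (1 - t))) ≤
      traceNorm (A + B + r • (mpow A t * mpow B (1 - t) + mpow A (1 - t) * mpow B t)) := by
  have hsymm : 1 - t ∈ Set.Icc (0 : ℝ) 1 := ⟨by linarith [ht.2], by linarith [ht.1]⟩
  have hpsd : (A + B + r • (geomMean A B t + geomMean A B (1 - t))).PosSemidef :=
    (hA.posSemidef.add hB.posSemidef).add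
      (((geomMean_posSemidef hA hB t).add (geomMean_posSemidef hA hB (1 - t))).smul hr)
  rw [traceNorm_eq_re_trace hpsd]
  refine le_trans ?_ (re_trace_le_traceNorm _)
  have h₁ := re_trace_geomMean_le hA hB ht
  have h₂ := re_trace_geomMean_le hA hB hsymm
  rw [sub_sub_cancel] at h₂
  simp only [trace_add, trace_smul, Complex.add_re, Complex.smul_re, smul_eq_mul]
  linarith [mul_le_mul_of_nonneg_left (add_le_add h₁ h₂) hr]
end
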